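/- Let 0 < β < 1. Assume the core energies Q_GL and Q_{[1,1]}(β) exist, and for each ε ∈ (0,1) let Ψ_ε be admissible with degrees (1,1) with E_ε(Ψ_ε) = I_{[1,1]}(ε;β), and let S_ε denote the spin of Ψ_ε. Then Q_GL ≤ Q_{[1,1]}(β) + (1−β)·liminf_{ε→0⁺} (1/ε²)·∫_{D₁} S_ε² dx. -/

import Mathlib

open MeasureTheory Metric Set Filter Complex

noncomputable section

/-- Sum of squared norms of the two first-order partial derivatives (plane identified with `ℂ`). -/
def gradSq (f : ℂ → ℂ) (x : ℂ) : ℝ :=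
  ‖fderiv ℝ f x 1‖ ^ 2 + ‖fderiv ℝ f x Complex.I‖ ^ 2

/-- Two-component Ginzburg–Landau energy density on the unit disk. -/
def eDen (ε β : ℝ) (ψp ψm : ℂ → ℂ) (x : ℂ) : ℝ :=
  (1 / 2) * (gradSq ψp x + gradSq ψm x)
    + (1 / (4 * ε ^ 2)) * ((‖ψp x‖ ^ 2 + ‖ψm x‖ ^ 2 - 1) ^ 2)
    + (β / (4 * ε ^ 2)) * ((‖ψp x‖ ^ 2 - ‖ψm x‖ ^ 2) ^ 2)

/-- Two-component Ginzburg–Landau energy on the unit disk. -/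
def En (ε β : ℝ) (ψp ψm : ℂ → ℂ) : ℝ := ∫ x in ball (0 : ℂ) 1, eDen ε β ψp ψm x

/-- Scalar Ginzburg–Landau energy density. -/
def gDen (ε : ℝ) (u : ℂ → ℂ) (x : ℂ) : ℝ :=
  (1 / 2) * gradSq u x + (1 / (4 * ε ^ 2)) * ((1 - ‖u x‖ ^ 2) ^ 2)

/-- Scalar Ginzburg–Landau energy on the unit disk. -/
def Gn (ε : ℝ) (u : ℂ → ℂ) : ℝ := ∫ x in ball (0 : ℂ) 1, gDen ε u x

/-- Admissible two-component map with boundary degrees `(np, nm)`. -/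
def AdmissiblePair (ε β : ℝ) (np nm : ℕ) (ψp ψm : ℂ → ℂ) : Prop :=
  ContinuousOn ψp (closedBall 0 1) ∧ ContinuousOn ψm (closedBall 0 1) ∧
  ContDiffOn ℝ 1 ψp (ball 0 1) ∧ ContDiffOn ℝ 1 ψm (ball 0 1) ∧
  IntegrableOn (eDen ε β ψp ψm) (ball 0 1) ∧
  ∀ x : ℂ, ‖x‖ = 1 →
    ψp x = (Real.sqrt 2 : ℂ)⁻¹ * x ^ np ∧ ψm x = (Real.sqrt 2 : ℂ)⁻¹ * x ^ nm

/-- The infimum `I_{[np,nm]}(ε;β)`. -/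
def Ival (ε β : ℝ) (np nm : ℕ) : ℝ :=
  sInf { e : ℝ | ∃ ψp ψm : ℂ → ℂ, AdmissiblePair ε β np nm ψp ψm ∧ e = En ε β ψp ψm }

/-- Admissible scalar map with degree-one boundary condition. -/
def AdmissibleScalar (ε : ℝ) (u : ℂ → ℂ) : Prop :=
  ContinuousOn u (closedBall 0 1) ∧ ContDiffOn ℝ 1 u (ball 0 1) ∧
  IntegrableOn (gDen ε u) (ball 0 1) ∧ ∀ x : ℂ, ‖x‖ = 1 → u x = x

/-- The infimum `I_GL(ε)`. -/
def IGL (ε : ℝ) : ℝ :=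
  sInf { e : ℝ | ∃ u : ℂ → ℂ, AdmissibleScalar ε u ∧ e = Gn ε u }

/-- Spin of a two-component map. -/
def spin (ψp ψm : ℂ → ℂ) (x : ℂ) : ℝ := (1 / 2) * (‖ψm x‖ ^ 2 - ‖ψp x‖ ^ 2)

lemma gradSq_nonneg (f : ℂ → ℂ) (x : ℂ) : 0 ≤ gradSq f x := by
  unfold gradSq; positivity

lemma gradSq_const_mul (c : ℂ) (f : ℂ → ℂ) (x : ℂ) :
    gradSq (fun y => c * f y) x = ‖c‖ ^ 2 * gradSq f x := by
  have h : fderiv ℝ (fun y => c * f y) x = c • fderiv ℝ f x :=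
    congrFun (fderiv_const_smul_field (𝕜 := ℝ) (R := ℂ) (f := f) c) x
  simp only [gradSq, h, smul_apply, norm_smul]
  ring

lemma continuousOn_gradSq {f : ℂ → ℂ} {s : Set ℂ} (hs : IsOpen s) (hf : ContDiffOn ℝ 1 f s) :
    ContinuousOn (gradSq f) s := by
  have h := hf.continuousOn_fderiv_of_isOpen hs le_rfl
  unfold gradSq
  fun_prop

lemma norm_sqrt_two_sq : ‖(Real.sqrt 2 : ℂ)‖ ^ 2 = 2 := by
  rw [Complex.norm_real, Real.norm_eq_abs, sq_abs, Real.sq_sqrt (by norm_num)]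

lemma gDen_nonneg (ε : ℝ) (u : ℂ → ℂ) (x : ℂ) : 0 ≤ gDen ε u x := by
  have := gradSq_nonneg u x
  unfold gDen; positivity

lemma IGL_le_Gn {ε : ℝ} {u : ℂ → ℂ} (hu : AdmissibleScalar ε u) : IGL ε ≤ Gn ε u := by
  refine csInf_le ⟨0, ?_⟩ ⟨u, hu, rfl⟩
  rintro e ⟨v, -, rfl⟩
  exact integral_nonneg fun x => gDen_nonneg ε v x

/-- Changing the anisotropy parameter changes the energy density by a multiple of the squared
spin. -/
lemma eDen_eq_add_spin (ε β γ : ℝ) (ψp ψm : ℂ → ℂ) (x : ℂ) :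
    eDen ε β ψp ψm x = eDen ε γ ψp ψm x + (β - γ) * ((1 / ε ^ 2) * spin ψp ψm x ^ 2) := by
  unfold eDen spin; ring

/-- The rescaled components are controlled by the two-component density. -/
lemma gDen_add_gDen_le {ε γ : ℝ} (hγ0 : 0 < γ) (hγ1 : γ ≤ 1) (ψp ψm : ℂ → ℂ) (x : ℂ) :
    gDen (ε / Real.sqrt γ) (fun y => Real.sqrt 2 * ψp y) x
      + gDen (ε / Real.sqrt γ) (fun y => Real.sqrt 2 * ψm y) x
      ≤ 2 * eDen ε γ ψp ψm x := by
  have hδ : 1 / (4 * (ε / Real.sqrt γ) ^ 2) = γ * (1 / (4 * ε ^ 2)) := by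
    rw [div_pow, Real.sq_sqrt hγ0.le]
    field_simp
  unfold gDen eDen
  simp only [gradSq_const_mul, norm_mul, mul_pow, norm_sqrt_two_sq, hδ]
  have hk : 0 ≤ 1 / (4 * ε ^ 2) := by positivity
  have h := mul_nonneg (mul_nonneg hk (sub_nonneg.2 hγ1))
    (sq_nonneg (‖ψp x‖ ^ 2 + ‖ψm x‖ ^ 2 - 1))
  rw [show γ / (4 * ε ^ 2) = γ * (1 / (4 * ε ^ 2)) by ring]
  generalize 1 / (4 * ε ^ 2) = k at *
  linarith

namespace AdmissiblePair

variable {ε β : ℝ} {np nm : ℕ} {ψp ψm : ℂ → ℂ}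

lemma integrableOn_spin_sq (h : AdmissiblePair ε β np nm ψp ψm) :
    IntegrableOn (fun x => spin ψp ψm x ^ 2) (ball 0 1) := by
  obtain ⟨hp, hm, -⟩ := h
  have hc : ContinuousOn (fun x => spin ψp ψm x ^ 2) (closedBall 0 1) := by
    unfold spin; fun_prop
  exact (hc.integrableOn_compact (isCompact_closedBall 0 1)).mono_set ball_subset_closedBall

lemma integrableOn_eDen (h : AdmissiblePair ε β np nm ψp ψm) (γ : ℝ) :
    IntegrableOn (eDen ε γ ψp ψm) (ball 0 1) := by
  have hs := (h.integrableOn_spin_sq.const_mul (1 / ε ^ 2)).const_mul (γ - β)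
  exact (h.2.2.2.2.1.add hs).congr
    (Eventually.of_forall fun x => (eDen_eq_add_spin ε γ β ψp ψm x).symm)

lemma En_eq_add_spin (h : AdmissiblePair ε β np nm ψp ψm) (γ : ℝ) :
    En ε β ψp ψm = En ε γ ψp ψm
      + (β - γ) * ((1 / ε ^ 2) * ∫ x in ball (0 : ℂ) 1, spin ψp ψm x ^ 2) := by
  have hs := (h.integrableOn_spin_sq.const_mul (1 / ε ^ 2)).const_mul (β - γ)
  unfold En
  rw [← integral_const_mul, ← integral_const_mul, ← integral_add (h.integrableOn_eDen γ) hs]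
  exact integral_congr_ae (Eventually.of_forall fun x => eDen_eq_add_spin ε β γ ψp ψm x)

/-- A component of an admissible pair becomes an admissible scalar map after rescaling. -/
lemma admissibleScalar_of_le {δ γ : ℝ} {ψ : ℂ → ℂ} (h : AdmissiblePair ε β np nm ψp ψm)
    (hc : ContinuousOn ψ (closedBall 0 1)) (hd : ContDiffOn ℝ 1 ψ (ball 0 1))
    (hb : ∀ x : ℂ, ‖x‖ = 1 → ψ x = (Real.sqrt 2 : ℂ)⁻¹ * x)
    (hle : ∀ x, gDen δ (fun y => Real.sqrt 2 * ψ y) x ≤ 2 * eDen ε γ ψp ψm x) :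
    AdmissibleScalar δ (fun y => Real.sqrt 2 * ψ y) := by
  have hd' : ContDiffOn ℝ 1 (fun y => (Real.sqrt 2 : ℂ) * ψ y) (ball 0 1) :=
    contDiffOn_const.mul hd
  refine ⟨continuousOn_const.mul hc, hd', ?_, fun x hx => ?_⟩
  · have hg := continuousOn_gradSq isOpen_ball hd'
    have hu := hd'.continuousOn
    have hcont : ContinuousOn (gDen δ (fun y => Real.sqrt 2 * ψ y)) (ball 0 1) := by
      unfold gDen
      exact (continuousOn_const.mul hg).add
        (continuousOn_const.mul ((continuousOn_const.sub (hu.norm.pow 2)).pow 2))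
    refine ((h.integrableOn_eDen γ).const_mul 2).mono'
      (hcont.aestronglyMeasurable measurableSet_ball) (Eventually.of_forall fun x => ?_)
    rw [Real.norm_of_nonneg (gDen_nonneg _ _ _)]
    exact hle x
  · have h2 : (Real.sqrt 2 : ℂ) ≠ 0 := by
      simp
    simp only [hb x hx]
    rw [mul_inv_cancel_left₀ h2]

lemma IGL_le_En (h : AdmissiblePair ε β 1 1 ψp ψm) {γ : ℝ} (hγ0 : 0 < γ) (hγ1 : γ ≤ 1) :
    IGL (ε / Real.sqrt γ) ≤ En ε γ ψp ψm := by
  have hle := gDen_add_gDen_le (ε := ε) hγ0 hγ1 ψp ψm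
  have hp : AdmissibleScalar (ε / Real.sqrt γ) (fun y => Real.sqrt 2 * ψp y) :=
    h.admissibleScalar_of_le (γ := γ) h.1 h.2.2.1
      (fun x hx => by simpa using (h.2.2.2.2.2 x hx).1)
      (fun x => (le_add_of_nonneg_right (gDen_nonneg _ _ x)).trans (hle x))
  have hm : AdmissibleScalar (ε / Real.sqrt γ) (fun y => Real.sqrt 2 * ψm y) :=
    h.admissibleScalar_of_le (γ := γ) h.2.1 h.2.2.2.1
      (fun x hx => by simpa using (h.2.2.2.2.2 x hx).2)
      (fun x => (le_add_of_nonneg_left (gDen_nonneg _ _ x)).trans (hle x))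
  have hsum : Gn (ε / Real.sqrt γ) (fun y => Real.sqrt 2 * ψp y)
      + Gn (ε / Real.sqrt γ) (fun y => Real.sqrt 2 * ψm y) ≤ 2 * En ε γ ψp ψm := by
    unfold Gn En
    rw [← integral_add hp.2.2.1 hm.2.2.1, ← integral_const_mul]
    exact integral_mono (hp.2.2.1.add hm.2.2.1) ((h.integrableOn_eDen γ).const_mul 2) hle
  linarith [IGL_le_Gn hp, IGL_le_Gn hm]

end AdmissiblePair

/-- For `0 < β < 1`: if the core energies `Q_GL` and `Q_{[1,1]}(β)` exist and `Ψ_ε`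
are minimizers of `I_{[1,1]}(ε;β)` with spins `S_ε`, then
`Q_GL ≤ Q_{[1,1]}(β) + (1−β)·liminf_{ε→0⁺}(1/ε²)∫ S_ε²`. -/
theorem statement4 (β QGL Q11 : ℝ) (hβ0 : 0 < β) (hβ1 : β < 1)
    (hQGL : Tendsto (fun ε => IGL ε - Real.pi * Real.log (1 / ε))
      (nhdsWithin 0 (Ioi 0)) (nhds QGL))
    (hQ11 : Tendsto (fun ε => Ival ε β 1 1 - Real.pi * Real.log (1 / ε))
      (nhdsWithin 0 (Ioi 0)) (nhds Q11))
    (Ψp Ψm : ℝ → ℂ → ℂ)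
    (hΨ : ∀ ε ∈ Ioo (0 : ℝ) 1,
      AdmissiblePair ε β 1 1 (Ψp ε) (Ψm ε) ∧ En ε β (Ψp ε) (Ψm ε) = Ival ε β 1 1) :
    QGL ≤ Q11 + (1 - β) *
      Filter.liminf
        (fun ε => (1 / ε ^ 2) * ∫ x in ball (0 : ℂ) 1, (spin (Ψp ε) (Ψm ε) x) ^ 2)
        (nhdsWithin 0 (Ioi 0)) := by
  set F : ℝ → ℝ :=
    fun ε => (1 / ε ^ 2) * ∫ x in ball (0 : ℂ) 1, (spin (Ψp ε) (Ψm ε) x) ^ 2 with hF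
  have hsmall : ∀ᶠ ε : ℝ in nhdsWithin 0 (Ioi 0), ε ∈ Ioo (0 : ℝ) 1 :=
    Ioo_mem_nhdsGT one_pos
  have hlower : ∀ᶠ ε in nhdsWithin 0 (Ioi 0), IGL ε ≤ Ival ε β 1 1 + (1 - β) * F ε := by
    filter_upwards [hsmall] with ε hε
    obtain ⟨hadm, hmin⟩ := hΨ ε hε
    have h1 := hadm.IGL_le_En one_pos le_rfl
    have h2 := hadm.En_eq_add_spin 1
    rw [Real.sqrt_one, div_one] at h1
    rw [hmin] at h2
    simp only [hF]
    linarith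
  -- Comparison with the scalar energy at a larger scale bounds the spin term.
  have hupper : IsBoundedUnder (· ≤ ·) (nhdsWithin 0 (Ioi 0)) F := by
    have hs : 0 < Real.sqrt (β / 2) := Real.sqrt_pos.2 (by linarith)
    have hscale : Tendsto (fun ε : ℝ => ε / Real.sqrt (β / 2))
        (nhdsWithin 0 (Ioi 0)) (nhdsWithin 0 (Ioi 0)) := by
      refine tendsto_nhdsWithin_iff.2 ⟨?_, ?_⟩
      · have : Tendsto (fun ε : ℝ => ε / Real.sqrt (β / 2)) (nhds 0)
            (nhds (0 / Real.sqrt (β / 2))) := tendsto_id.div_const _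
        rw [zero_div] at this
        exact this.mono_left nhdsWithin_le_nhds
      · filter_upwards [self_mem_nhdsWithin] with ε hε
        exact div_pos hε hs
    have hdiff := hQ11.sub (hQGL.comp hscale)
    refine ⟨(Q11 - QGL + 1 - Real.pi * Real.log (Real.sqrt (β / 2))) / (β / 2), ?_⟩
    rw [eventually_map]
    filter_upwards [hsmall, hdiff.eventually_lt_const (lt_add_one _)] with ε hε hlt
    obtain ⟨hadm, hmin⟩ := hΨ ε hε
    have h1 := hadm.IGL_le_En (γ := β / 2) (by linarith) (by linarith)
    have h2 := hadm.En_eq_add_spin (β / 2)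
    rw [hmin] at h2
    have hlog : Real.log (1 / (ε / Real.sqrt (β / 2)))
        = Real.log (1 / ε) + Real.log (Real.sqrt (β / 2)) := by
      rw [one_div_div, div_eq_inv_mul, ← one_div,
        Real.log_mul (one_div_pos.2 hε.1).ne' hs.ne']
    simp only [Function.comp_apply, hlog] at hlt
    rw [le_div_iff₀ (by linarith)]
    simp only [hF]
    linarith
  have hlim : (QGL - Q11) / (1 - β) ≤ liminf F (nhdsWithin 0 (Ioi 0)) := by
    refine le_of_forall_lt fun c hc => ?_
    obtain ⟨d, hcd, hd⟩ := exists_between hc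
    refine hcd.trans_le (le_liminf_of_le hupper.isCoboundedUnder_ge ?_)
    rw [lt_div_iff₀ (by linarith)] at hd
    filter_upwards [hlower, (hQGL.sub hQ11).eventually_const_lt hd] with ε h1 h2
    have : d * (1 - β) ≤ F ε * (1 - β) := by linarith
    exact le_of_mul_le_mul_right this (by linarith)
  rw [div_le_iff₀ (by linarith)] at hlim
  linarith
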